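/- arXiv:0810.0352 — 2 statements merged into one kernel-verified Lean document; each statement's English description precedes it below -/
import Mathlib

section
/- Let n ≥ 3 and let S_n be the monoid presented by generators a_1, …, a_n and relations a_1 a_2 ⋯ a_n = a_{σ(1)} ⋯ a_{σ(n)} for σ in the cyclic group generated by the n-cycle. Let F be the free group on generators x_1, …, x_{n-1}, let C be an infinite cyclic group with generator c, and define a monoid homomorphism φ : S_n → F × C by φ(a_i) = x_i for 1 ≤ i ≤ n−1 and φ(a_n) = (x_1 x_2 ⋯ x_{n-1})^{-1} c. Then φ is a well-defined injective monoid homomorphism. -/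
/-- The word `a_{σ(1)} a_{σ(2)} ⋯ a_{σ(n)}` in the free monoid on `n` generators. -/
def permWord (n : ℕ) (σ : Equiv.Perm (Fin n)) : FreeMonoid (Fin n) :=
  ((List.finRange n).map fun i => FreeMonoid.of (σ i)).prod

/-- The defining relations `a_1 a_2 ⋯ a_n = a_{σ(1)} a_{σ(2)} ⋯ a_{σ(n)}`, where `σ` runs
through the cyclic subgroup of `Sym_n` generated by the `n`-cycle `(1,2,…,n)` (i.e. `finRotate n`). -/
def cycRel (n : ℕ) : FreeMonoid (Fin n) → FreeMonoid (Fin n) → Prop :=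
  fun x y => x = permWord n 1 ∧ ∃ k : ℕ, y = permWord n (finRotate n ^ k)

/-- The monoid `S_n` presented by generators `a_1, …, a_n` and the above relations. -/
def Scyc (n : ℕ) : Type := (conGen (cycRel n)).Quotient

instance (n : ℕ) : Monoid (Scyc n) := Con.monoid _

/-- The generator `a_i` of `S_n`. -/
def agen {n : ℕ} (i : Fin n) : Scyc n := (conGen (cycRel n)).mk' (FreeMonoid.of i)

/-- The element `z = a_1 a_2 ⋯ a_n` of `S_n`. -/
def zc (n : ℕ) : Scyc n := ((List.finRange n).map agen).prod

/-- The product of `f` over the `m` cyclically consecutive indices starting at `i`. -/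
def cyclicRun {n : ℕ} {M : Type*} [Monoid M] (f : Fin n → M) (i : Fin n) (m : ℕ) : M :=
  ((List.range m).map fun t => f ((finRotate n ^ t) i)).prod

section cyclicRun

variable {n : ℕ} {M N : Type*} [Monoid M] [Monoid N]

@[simp]
theorem cyclicRun_zero (f : Fin n → M) (i : Fin n) : cyclicRun f i 0 = 1 := rfl

theorem cyclicRun_succ (f : Fin n → M) (i : Fin n) (m : ℕ) :
    cyclicRun f i (m + 1) = f i * cyclicRun f (finRotate n i) m := by
  simp [cyclicRun, List.range_succ_eq_map, Function.comp_def, pow_succ]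

theorem cyclicRun_add (f : Fin n → M) (i : Fin n) (m l : ℕ) :
    cyclicRun f i (m + l) = cyclicRun f i m * cyclicRun f ((finRotate n ^ m) i) l := by
  induction m generalizing i with
  | zero => simp
  | succ m ih => rw [Nat.succ_add, cyclicRun_succ, ih, cyclicRun_succ, mul_assoc, pow_succ]; rfl

theorem cyclicRun_one (f : Fin n → M) (i : Fin n) : cyclicRun f i 1 = f i := by
  simp [cyclicRun_succ]

theorem map_cyclicRun (g : M →* N) (f : Fin n → M) (i : Fin n) (m : ℕ) :
    g (cyclicRun f i m) = cyclicRun (fun j => g (f j)) i m := by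
  simp [cyclicRun, map_list_prod, Function.comp_def]

theorem finRotate_pow_apply (n t : ℕ) (i : Fin (n + 1)) :
    (finRotate (n + 1) ^ t) i = i + Fin.ofNat (n + 1) t := by
  induction t with
  | zero => ext; simp
  | succ t ih =>
    rw [pow_succ', Equiv.Perm.mul_apply, ih, finRotate_apply, add_assoc]
    congr 1
    ext
    simp [Fin.val_add]

theorem finRotate_pow_self (n : ℕ) : finRotate n ^ n = 1 := by
  cases n with
  | zero => rfl
  | succ n =>
    ext i
    simp [finRotate_pow_apply]

theorem finRotate_pow_pred_apply {n m : ℕ} (h : m + 1 = n) (i : Fin n) :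
    (finRotate n ^ m) (finRotate n i) = i := by
  rw [← Equiv.Perm.mul_apply, ← pow_succ, h, finRotate_pow_self, Equiv.Perm.one_apply]

theorem prod_map_finRange_finRotate_pow (f : Fin (n + 1) → M) (k : ℕ) :
    ((List.finRange (n + 1)).map fun i => f ((finRotate (n + 1) ^ k) i)).prod =
      cyclicRun f ((finRotate (n + 1) ^ k) 0) (n + 1) := by
  rw [cyclicRun, ← List.map_coe_finRange_eq_range, List.map_map]
  congr 1
  refine List.map_congr_left fun i _ => ?_
  simp [finRotate_pow_apply, add_comm]

theorem prod_map_finRange_eq_cyclicRun (f : Fin (n + 1) → M) :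
    ((List.finRange (n + 1)).map f).prod = cyclicRun f 0 (n + 1) := by
  simpa using prod_map_finRange_finRotate_pow f 0

theorem mul_cyclicRun_pred {n m : ℕ} (h : m + 1 = n) (f : Fin n → M) (i : Fin n) :
    f i * cyclicRun f (finRotate n i) m = cyclicRun f i n := by
  subst h
  exact (cyclicRun_succ f i m).symm

theorem cyclicRun_pred_mul {n m : ℕ} (h : m + 1 = n) (f : Fin n → M) (i : Fin n) :
    cyclicRun f (finRotate n i) m * f i = cyclicRun f (finRotate n i) n := by
  subst h
  rw [cyclicRun_add, cyclicRun_one, finRotate_pow_pred_apply rfl]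

theorem cyclicRun_full_eq_of_central {G : Type*} [Group G] (f : Fin (n + 1) → G)
    (hc : ∀ g, Commute (cyclicRun f 0 (n + 1)) g) (k : ℕ) :
    cyclicRun f ((finRotate (n + 1) ^ k) 0) (n + 1) = cyclicRun f 0 (n + 1) := by
  induction k with
  | zero => rfl
  | succ k ih =>
    rw [pow_succ', Equiv.Perm.mul_apply, ← cyclicRun_pred_mul rfl]
    apply mul_left_cancel (a := f ((finRotate (n + 1) ^ k) 0))
    rw [← mul_assoc, mul_cyclicRun_pred rfl, ih, (hc _).eq]

end cyclicRun

namespace Scyc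

variable {n : ℕ}

theorem cyclicRun_agen (k : ℕ) :
    cyclicRun agen ((finRotate (n + 1) ^ k) 0) (n + 1) = zc (n + 1) := by
  have h : conGen (cycRel (n + 1)) (permWord (n + 1) 1)
      (permWord (n + 1) (finRotate (n + 1) ^ k)) := ConGen.Rel.of _ _ ⟨rfl, k, rfl⟩
  have h' := (Con.eq (conGen (cycRel (n + 1)))).2 h
  have key (l : ℕ) : (conGen (cycRel (n + 1))).mk' (permWord (n + 1) (finRotate (n + 1) ^ l)) =
      cyclicRun (agen (n := n + 1)) ((finRotate (n + 1) ^ l) 0) (n + 1) := by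
    rw [permWord, prod_map_finRange_finRotate_pow]
    exact map_cyclicRun (conGen (cycRel (n + 1))).mk' _ _ _
  rw [zc, prod_map_finRange_eq_cyclicRun]
  exact (key k).symm.trans (h'.symm.trans (key 0))

theorem cyclicRun_agen_full (i : Fin (n + 1)) : cyclicRun agen i (n + 1) = zc (n + 1) := by
  have h := cyclicRun_agen (n := n) i
  rwa [finRotate_pow_apply, zero_add, Fin.ofNat_eq_cast, Fin.cast_val_eq_self] at h

theorem commute_agen_zc (i : Fin (n + 1)) : Commute (agen i) (zc (n + 1)) := by
  have h : agen i * cyclicRun agen (finRotate (n + 1) i) n * agen i =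
      agen i * (cyclicRun agen (finRotate (n + 1) i) n * agen i) := mul_assoc _ _ _
  rw [mul_cyclicRun_pred rfl, cyclicRun_pred_mul rfl, cyclicRun_agen_full,
    cyclicRun_agen_full] at h
  exact h.symm

/-- The universal property of `Scyc (n + 1)`. -/
def lift {M : Type*} [Monoid M] (f : Fin (n + 1) → M)
    (hf : ∀ k : ℕ, cyclicRun f ((finRotate (n + 1) ^ k) 0) (n + 1) = cyclicRun f 0 (n + 1)) :
    Scyc (n + 1) →* M :=
  (conGen (cycRel (n + 1))).lift (FreeMonoid.lift f) <| Con.conGen_le.2 <| by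
    rintro _ _ ⟨rfl, k, rfl⟩
    have key (l : ℕ) : FreeMonoid.lift f (permWord (n + 1) (finRotate (n + 1) ^ l)) =
        cyclicRun f ((finRotate (n + 1) ^ l) 0) (n + 1) := by
      rw [permWord, prod_map_finRange_finRotate_pow, map_cyclicRun]
      simp
    exact (key 0).trans ((hf k).symm.trans (key k).symm)

theorem lift_agen {M : Type*} [Monoid M] (f : Fin (n + 1) → M) (hf) (i : Fin (n + 1)) :
    lift f hf (agen i) = f i := by
  exact FreeMonoid.lift_eval_of f i

@[elab_as_elim]
theorem induction_on {p : Scyc n → Prop} (s : Scyc n) (one : p 1)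
    (agen_mul : ∀ i s, p s → p (agen i * s)) : p s := by
  obtain ⟨w, rfl⟩ := Con.mk'_surjective s
  induction w using FreeMonoid.inductionOn' with
  | one => exact one
  | of_mul i w ih => exact agen_mul i _ ih

theorem hom_ext {M : Type*} [Monoid M] {f g : Scyc n →* M} (h : ∀ i, f (agen i) = g (agen i)) :
    f = g := by
  ext s
  induction s using induction_on with
  | one => simp
  | agen_mul i s ih => rw [map_mul, map_mul, h, ih]

/-- The first block of `t` does not start at the index `i`. -/
def HeadNe (i : Fin n) : List (Fin n × ℕ) → Prop
  | [] => True
  | p :: _ => p.1 ≠ i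

/-- A list of pairs `(i, j)`, standing for the word `a_i a_{i+1} ⋯ a_{i+j-1}`, is the
decomposition into maximal cyclic runs of a word without cyclic runs of length `n`. -/
def Reduced : List (Fin n × ℕ) → Prop
  | [] => True
  | p :: t => 1 ≤ p.2 ∧ p.2 < n ∧ HeadNe ((finRotate n ^ p.2) p.1) t ∧ Reduced t

/-- Multiply `z ^ k` times a reduced word by `a_i` on the left. -/
def push (i : Fin n) : ℤ × List (Fin n × ℕ) → ℤ × List (Fin n × ℕ)
  | (k, []) => (k, [(i, 1)])
  | (k, p :: t) =>
    if p.1 = finRotate n i then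
      if p.2 + 1 = n then (k + 1, t) else (k, (i, p.2 + 1) :: t)
    else (k, (i, 1) :: p :: t)

theorem reduced_push (hn : 2 ≤ n) (i : Fin n) (x : ℤ × List (Fin n × ℕ)) (hx : Reduced x.2) :
    Reduced (push i x).2 := by
  obtain ⟨k, _ | ⟨⟨a, j⟩, t⟩⟩ := x
  · exact ⟨le_rfl, hn, trivial, trivial⟩
  · obtain ⟨h1, h2, h3, h4⟩ := hx
    dsimp only at h1 h2 h3 h4
    simp only [push]
    split_ifs with ha hj
    · exact h4
    · refine ⟨Nat.le_add_left _ _, by dsimp only at hj ⊢; omega, ?_, h4⟩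
      dsimp only at ha ⊢
      rwa [pow_succ, Equiv.Perm.mul_apply, ← ha]
    · exact ⟨le_rfl, hn, by simpa [HeadNe] using ha, h1, h2, h3, h4⟩

theorem push_of_headNe {i : Fin n} {t : List (Fin n × ℕ)} (h : HeadNe (finRotate n i) t) (k : ℤ) :
    push i (k, t) = (k, (i, 1) :: t) := by
  cases t with
  | nil => rfl
  | cons p t => exact if_neg h

theorem push_of_lt {i : Fin n} {j : ℕ} (hj : j + 1 < n) (k : ℤ) (t : List (Fin n × ℕ)) :
    push i (k, (finRotate n i, j) :: t) = (k, (i, j + 1) :: t) := by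
  simp [push, hj.ne]

theorem push_of_eq {i : Fin n} {j : ℕ} (hj : j + 1 = n) (k : ℤ) (t : List (Fin n × ℕ)) :
    push i (k, (finRotate n i, j) :: t) = (k + 1, t) := by
  simp [push, hj]

/-- Pairs of an integer exponent of `z` and a reduced word. -/
abbrev State (n : ℕ) : Type := {x : ℤ × List (Fin n × ℕ) // Reduced x.2}

/-- The action of the generators on `State n`. -/
def act (hn : 2 ≤ n) (i : Fin n) : Function.End (State n) :=
  fun x => ⟨push i x.1, reduced_push hn i x.1 x.2⟩

theorem cyclicRun_act_of_headNe (hn : 2 ≤ n) (m : ℕ) (hm : m + 1 < n) (i : Fin n) (x : State n)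
    (h : HeadNe ((finRotate n ^ (m + 1)) i) x.1.2) :
    (cyclicRun (act hn) i (m + 1) x).1 = (x.1.1, (i, m + 1) :: x.1.2) := by
  induction m generalizing i with
  | zero =>
    rw [zero_add, cyclicRun_one]
    exact push_of_headNe h _
  | succ m ih =>
    rw [cyclicRun_succ]
    change push i (cyclicRun (act hn) (finRotate n i) (m + 1) x).1 = _
    rw [ih (by omega) _ (by rwa [← Equiv.Perm.mul_apply, ← pow_succ]), push_of_lt hm]

theorem cyclicRun_act_of_cons (hn : 2 ≤ n) (m j : ℕ) (hm : m + j < n) (i a : Fin n) (x : State n)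
    (k : ℤ) (t : List (Fin n × ℕ)) (hx : x.1 = (k, (a, j) :: t)) (ha : a = (finRotate n ^ m) i) :
    (cyclicRun (act hn) i m x).1 = (k, (i, m + j) :: t) := by
  induction m generalizing i with
  | zero => simpa [ha, Function.End.one_def] using hx
  | succ m ih =>
    rw [cyclicRun_succ]
    change push i (cyclicRun (act hn) (finRotate n i) m x).1 = _
    rw [ih (by omega) _ (by rwa [← Equiv.Perm.mul_apply, ← pow_succ]), push_of_lt (by omega)]
    congr 3
    omega

/-- The action of `z` on `State n`. -/
def shift (n : ℕ) : (Function.End (State n))ˣ where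
  val x := ⟨(x.1.1 + 1, x.1.2), x.2⟩
  inv x := ⟨(x.1.1 - 1, x.1.2), x.2⟩
  val_inv := funext fun x => Subtype.ext (Prod.ext (sub_add_cancel x.1.1 1) rfl)
  inv_val := funext fun x => Subtype.ext (Prod.ext (add_sub_cancel_right x.1.1 1) rfl)

theorem cyclicRun_act_of_headNe_self (hn : 2 ≤ n) (i : Fin n) (x : State n)
    (h : HeadNe i x.1.2) : cyclicRun (act hn) i n x = (shift n).val x := by
  obtain ⟨m, rfl⟩ : ∃ m, n = m + 1 + 1 := ⟨n - 2, by omega⟩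
  apply Subtype.ext
  rw [cyclicRun_succ]
  change push i (cyclicRun (act hn) _ (m + 1) x).1 = _
  rw [cyclicRun_act_of_headNe hn _ (by omega) _ _ (by rwa [finRotate_pow_pred_apply rfl]),
    push_of_eq rfl]
  rfl

theorem cyclicRun_act_of_cons_self (hn : 2 ≤ n) (i : Fin n) (j : ℕ) (x : State n)
    (k : ℤ) (t : List (Fin n × ℕ)) (hx : x.1 = (k, (i, j) :: t)) :
    cyclicRun (act hn) i n x = (shift n).val x := by
  have hr : Reduced ((i, j) :: t) := by simpa [hx] using x.2
  obtain ⟨h1, h2, h3, h4⟩ := hr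
  dsimp only at h1 h2 h3
  obtain ⟨l, hl⟩ : ∃ l, n = j + (l + 1) := ⟨n - j - 1, by omega⟩
  have hsplit : cyclicRun (act hn) i n = cyclicRun (act hn) i j *
      (act hn ((finRotate n ^ j) i) *
        cyclicRun (act hn) (finRotate n ((finRotate n ^ j) i)) l) := by
    rw [← cyclicRun_succ, ← cyclicRun_add, ← hl]
  have hrot : i = (finRotate n ^ l) (finRotate n ((finRotate n ^ j) i)) := by
    rw [← Equiv.Perm.mul_apply, ← Equiv.Perm.mul_apply, ← pow_succ, ← pow_add,
      show l + 1 + j = n by omega, finRotate_pow_self, Equiv.Perm.one_apply]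
  have hpop : (act hn ((finRotate n ^ j) i)
      (cyclicRun (act hn) (finRotate n ((finRotate n ^ j) i)) l x)).1 = (k + 1, t) := by
    change push _ (cyclicRun (act hn) _ l x).1 = _
    rw [cyclicRun_act_of_cons hn l j (by omega) _ i x k t hx hrot, push_of_eq (by omega)]
  obtain ⟨j, rfl⟩ : ∃ j', j = j' + 1 := ⟨j - 1, by omega⟩
  apply Subtype.ext
  rw [hsplit]
  change (cyclicRun (act hn) i (j + 1) (act hn _ (cyclicRun (act hn) _ l x))).1 = _
  rw [cyclicRun_act_of_headNe hn j h2 _ _ (by rwa [hpop]), hpop]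
  simp [shift, hx]

theorem cyclicRun_act (hn : 2 ≤ n) (i : Fin n) :
    cyclicRun (act hn) i n = (shift n).val := by
  funext x
  obtain ⟨⟨k, _ | ⟨⟨a, j⟩, t⟩⟩, hx⟩ := x
  · exact cyclicRun_act_of_headNe_self hn i _ trivial
  · by_cases h : a = i
    · subst h
      exact cyclicRun_act_of_cons_self hn a j _ k t rfl
    · exact cyclicRun_act_of_headNe_self hn i _ h

theorem isUnit_act (hn : 2 ≤ n) (i : Fin n) : IsUnit (act hn i) := by
  have hm : n - 1 + 1 = n := by omega
  refine isUnit_iff_exists_and_exists.2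
    ⟨⟨cyclicRun (act hn) (finRotate n i) (n - 1) * (shift n)⁻¹.val, ?_⟩,
      ⟨(shift n)⁻¹.val * cyclicRun (act hn) (finRotate n i) (n - 1), ?_⟩⟩
  · rw [← mul_assoc, mul_cyclicRun_pred hm, cyclicRun_act, Units.mul_inv]
  · rw [mul_assoc, cyclicRun_pred_mul hm, cyclicRun_act, Units.inv_mul]

/-- The action of the generators on `State n` by invertible maps. -/
noncomputable def actUnit (hn : 2 ≤ n) (i : Fin n) : (Function.End (State n))ˣ :=
  (isUnit_act hn i).unit

theorem cyclicRun_actUnit (hn : 2 ≤ n) (i : Fin n) :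
    cyclicRun (actUnit hn) i n = shift n := by
  apply Units.ext
  rw [← cyclicRun_act hn i]
  exact map_cyclicRun (Units.coeHom _) _ _ _

/-- The action of `Scyc (n + 1)` on `State (n + 1)`. -/
noncomputable def toUnits (hn : 2 ≤ n + 1) : Scyc (n + 1) →* (Function.End (State (n + 1)))ˣ :=
  lift (actUnit hn) fun k => by rw [cyclicRun_actUnit, cyclicRun_actUnit]

theorem toUnits_agen (hn : 2 ≤ n + 1) (i : Fin (n + 1)) :
    toUnits hn (agen i) = actUnit hn i :=
  lift_agen _ _ _

/-- The element of `Scyc n` represented by a list of cyclic runs. -/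
def ofRuns (t : List (Fin n × ℕ)) : Scyc n :=
  (t.map fun p => cyclicRun agen p.1 p.2).prod

theorem ofRuns_cons (p : Fin n × ℕ) (t : List (Fin n × ℕ)) :
    ofRuns (p :: t) = cyclicRun agen p.1 p.2 * ofRuns t := by
  simp [ofRuns]

theorem exists_push_eq (i : Fin (n + 1)) (k : ℕ) (t : List (Fin (n + 1) × ℕ)) :
    ∃ l : ℕ, (push i (k, t)).1 = l ∧
      agen i * (zc (n + 1) ^ k * ofRuns t) = zc (n + 1) ^ l * ofRuns (push i (k, t)).2 := by
  rw [← mul_assoc, ((commute_agen_zc i).pow_right k).eq, mul_assoc]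
  rcases t with _ | ⟨⟨a, j⟩, t⟩
  · exact ⟨k, rfl, by simp [push, ofRuns, cyclicRun_one]⟩
  · simp only [push]
    split_ifs with ha hj
    · obtain rfl : j = n := by simpa using hj
      refine ⟨k + 1, by simp, ?_⟩
      dsimp only at ha ⊢
      rw [ofRuns_cons, ha, ← mul_assoc (agen i), mul_cyclicRun_pred rfl, cyclicRun_agen_full,
        pow_succ, mul_assoc]
    · refine ⟨k, rfl, ?_⟩
      dsimp only at ha ⊢
      rw [ofRuns_cons, ofRuns_cons, ha, ← mul_assoc (agen i), ← cyclicRun_succ]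
    · exact ⟨k, rfl, by simp only [ofRuns_cons, cyclicRun_one]⟩

theorem exists_toUnits_eq (hn : 2 ≤ n + 1) (s : Scyc (n + 1)) :
    ∃ l : ℕ, ((toUnits hn s).val ⟨(0, []), trivial⟩).1.1 = l ∧
      s = zc (n + 1) ^ l * ofRuns ((toUnits hn s).val ⟨(0, []), trivial⟩).1.2 := by
  induction s using induction_on with
  | one => exact ⟨0, by simp [Function.End.one_def], by simp [ofRuns, Function.End.one_def]⟩
  | agen_mul i s ih =>
    obtain ⟨l, hl, hs⟩ := ih
    obtain ⟨l', hl', hs'⟩ :=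
      exists_push_eq i l ((toUnits hn s).val ⟨(0, []), trivial⟩).1.2
    have key : ((toUnits hn (agen i * s)).val ⟨(0, []), trivial⟩).1 =
        push i (l, ((toUnits hn s).val ⟨(0, []), trivial⟩).1.2) := by
      rw [map_mul, toUnits_agen, ← hl]
      rfl
    rw [key]
    exact ⟨l', hl', by rw [← hs', ← hs]⟩

theorem toUnits_injective (hn : 2 ≤ n + 1) : Function.Injective (toUnits hn) := by
  intro s t h
  obtain ⟨k, hk, hs⟩ := exists_toUnits_eq hn s
  obtain ⟨l, hl, ht⟩ := exists_toUnits_eq hn t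
  rw [h] at hk hs
  obtain rfl : k = l := by exact_mod_cast hk.symm.trans hl
  exact hs.trans ht.symm

/-- The images of the generators in `F × C`. -/
def genImage (n : ℕ) : Fin (n + 1) → FreeGroup (Fin n) × Multiplicative ℤ :=
  Fin.lastCases
    ((((List.finRange n).map FreeGroup.of).prod)⁻¹, Multiplicative.ofAdd (1 : ℤ))
    fun i => (FreeGroup.of i, 1)

@[simp]
theorem genImage_castSucc (i : Fin n) : genImage n i.castSucc = (FreeGroup.of i, 1) := by
  simp [genImage]

@[simp]
theorem genImage_last : genImage n (Fin.last n) =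
    ((((List.finRange n).map FreeGroup.of).prod)⁻¹, Multiplicative.ofAdd (1 : ℤ)) := by
  simp [genImage]

theorem cyclicRun_zero_eq_prod_mul_last {M : Type*} [Monoid M] (f : Fin (n + 1) → M) :
    cyclicRun f 0 (n + 1) =
      ((List.finRange n).map fun i => f i.castSucc).prod * f (Fin.last n) := by
  simp [← prod_map_finRange_eq_cyclicRun, List.finRange_succ_last, Function.comp_def]

theorem cyclicRun_genImage : cyclicRun (genImage n) 0 (n + 1) =
    (1, Multiplicative.ofAdd (1 : ℤ)) := by
  have h : ((List.finRange n).map fun i => genImage n i.castSucc).prod =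
      MonoidHom.inl _ _ ((List.finRange n).map FreeGroup.of).prod := by
    rw [map_list_prod, List.map_map]
    simp [Function.comp_def]
  rw [cyclicRun_zero_eq_prod_mul_last, h, genImage_last]
  simp

/-- The homomorphism `φ : S_n → F × C`. -/
def toFreeGroupProd (n : ℕ) : Scyc (n + 1) →* FreeGroup (Fin n) × Multiplicative ℤ :=
  lift (genImage n) <| cyclicRun_full_eq_of_central _ fun g => by
    rw [cyclicRun_genImage]
    exact Prod.ext (by simp) (mul_comm _ _)

theorem toFreeGroupProd_agen (i : Fin (n + 1)) : toFreeGroupProd n (agen i) = genImage n i :=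
  lift_agen _ _ _

theorem commute_actUnit_shift (hn : 2 ≤ n + 1) (i : Fin (n + 1)) :
    Commute (actUnit hn i) (shift (n + 1)) := by
  have h := (commute_agen_zc i).map (toUnits hn)
  rwa [← cyclicRun_agen_full i, map_cyclicRun, toUnits_agen,
    funext (toUnits_agen hn), cyclicRun_actUnit] at h

theorem toFreeGroupProd_injective (hn : 2 ≤ n + 1) :
    Function.Injective (toFreeGroupProd n) := by
  let α : FreeGroup (Fin n) →* (Function.End (State (n + 1)))ˣ :=
    FreeGroup.lift fun i => actUnit hn i.castSucc
  let β := zpowersHom (Function.End (State (n + 1)))ˣ (shift (n + 1))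
  have hcomm (g c) : Commute (α g) (β c) := by
    refine Commute.zpow_right ?_ _
    induction g using FreeGroup.induction_on with
    | C1 => simp
    | of i => simpa [α] using commute_actUnit_shift hn i.castSucc
    | inv_of i h => simpa using h
    | mul g h hg hh => rw [map_mul]; exact hg.mul_left hh
  have hcomp : (MonoidHom.noncommCoprod α β hcomm).comp (toFreeGroupProd n) = toUnits hn := by
    refine hom_ext fun i => ?_
    rw [MonoidHom.comp_apply, toFreeGroupProd_agen, toUnits_agen]
    induction i using Fin.lastCases with
    | cast i => simp [MonoidHom.noncommCoprod_apply, α]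
    | last =>
      have h := cyclicRun_zero_eq_prod_mul_last (actUnit hn)
      rw [cyclicRun_actUnit] at h
      simp [MonoidHom.noncommCoprod_apply, α, β, map_list_prod, Function.comp_def, h]
  apply Function.Injective.of_comp (f := MonoidHom.noncommCoprod α β hcomm)
  rw [← MonoidHom.coe_comp, hcomp]
  exact toUnits_injective hn

end Scyc

/-- there is a well-defined injective monoid homomorphism
`φ : S_n → F × C` with `φ(a_i) = x_i` for `1 ≤ i ≤ n-1` and `φ(a_n) = (x_1 ⋯ x_{n-1})⁻¹ c`,
where `F` is the free group of rank `n-1` and `C` is infinite cyclic with generator `c`. -/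
theorem embedding_into_F_times_C (n : ℕ) (hn : 3 ≤ n) :
    ∃ φ : Scyc n →* FreeGroup (Fin (n - 1)) × Multiplicative ℤ,
      (∀ i : Fin n, ∀ h : (i : ℕ) < n - 1, φ (agen i) = (FreeGroup.of ⟨(i : ℕ), h⟩, 1)) ∧
      φ (agen (⟨n - 1, by omega⟩ : Fin n)) =
        ((((List.finRange (n - 1)).map FreeGroup.of).prod)⁻¹, Multiplicative.ofAdd (1 : ℤ)) ∧
      Function.Injective φ := by
  obtain ⟨n, rfl⟩ : ∃ m, n = m + 1 := ⟨n - 1, by omega⟩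
  refine ⟨Scyc.toFreeGroupProd n, fun i h => ?_, ?_,
    Scyc.toFreeGroupProd_injective (by omega)⟩
  · exact (Scyc.toFreeGroupProd_agen i).trans (Scyc.genImage_castSucc ⟨i, h⟩)
  · exact (Scyc.toFreeGroupProd_agen (Fin.last n)).trans Scyc.genImage_last
end

section
/- Let K be a field, n ≥ 3, and let S_n be the monoid presented by generators a_1, …, a_n and relations a_1 a_2 ⋯ a_n = a_{σ(1)} ⋯ a_{σ(n)} for σ in the cyclic group generated by the n-cycle. Let P = (a_1 ⋯ a_n)·S_n and let K[P] denote the K-linear span of P inside the monoid algebra K[S_n]. Then K[P] is a prime two-sided ideal of K[S_n]. -/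
theorem List.IsChain.infix_or_infix_of_infix_append {α : Type*} {R : α → α → Prop}
    {l u v : List α} (hl : l.IsChain R) (h : l <:+: u ++ v)
    (huv : ∀ x ∈ u.getLast?, ∀ y ∈ v.head?, ¬ R x y) : l <:+: u ∨ l <:+: v := by
  rw [List.infix_append_iff_ne_nil] at h
  rcases h with h | h | ⟨s, t, hs, ht, rfl, ⟨s', rfl⟩, ⟨t', rfl⟩⟩
  · exact Or.inl h
  · exact Or.inr h
  · have hR := (List.isChain_append.1 hl).2.2
    exact absurd
      (hR (s.getLast hs) (by simp [List.getLast?_eq_some_getLast hs])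
        (t.head ht) (by simp [List.head?_eq_some_head ht]))
      (huv _ (by simp [List.getLast?_append, List.getLast?_eq_some_getLast hs])
        _ (by simp [List.head?_append, List.head?_eq_some_head ht]))

theorem toList_permWord (n : ℕ) (σ : Equiv.Perm (Fin n)) :
    (permWord n σ).toList = (List.finRange n).map σ := by
  rw [permWord, FreeMonoid.toList_prod, List.map_map]
  induction List.finRange n with
  | nil => rfl
  | cons a l ih => simpa using ih

theorem isChain_permWord (n k : ℕ) :
    (permWord n (finRotate n ^ k)).toList.IsChain fun x y => y = finRotate n x := by
  rw [toList_permWord, List.isChain_iff_getElem]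
  intro i hi
  obtain _ | m := n
  · simp at hi
  simp only [List.length_map, List.length_finRange] at hi
  simp only [List.getElem_map, List.getElem_finRange]
  rw [← Equiv.Perm.mul_apply, ← pow_succ', pow_succ, Equiv.Perm.mul_apply]
  congr 1
  exact (finRotate_of_lt (by lia)).symm

/-- A word is cyclically divisible if one of the words `permWord n (finRotate n ^ k)` is a factor
of it. -/
def HasCyclicFactor {n : ℕ} (u : FreeMonoid (Fin n)) : Prop :=
  ∃ k : ℕ, (permWord n (finRotate n ^ k)).toList <:+: u.toList

namespace HasCyclicFactor

variable {n : ℕ} {u v : FreeMonoid (Fin n)}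

theorem permWord_finRotate (n k : ℕ) : HasCyclicFactor (permWord n (finRotate n ^ k)) :=
  ⟨k, List.infix_refl _⟩

theorem mul_right (h : HasCyclicFactor u) (v : FreeMonoid (Fin n)) : HasCyclicFactor (u * v) := by
  obtain ⟨k, h⟩ := h
  exact ⟨k, List.infix_append_of_infix_left h⟩

theorem mul_left (h : HasCyclicFactor u) (v : FreeMonoid (Fin n)) : HasCyclicFactor (v * u) := by
  obtain ⟨k, h⟩ := h
  exact ⟨k, List.infix_append_of_infix_right h⟩

theorem le_length (h : HasCyclicFactor u) : n ≤ u.length := by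
  obtain ⟨k, h⟩ := h
  have := h.length_le
  rwa [toList_permWord, List.length_map, List.length_finRange] at this

end HasCyclicFactor

theorem exists_not_hasCyclicFactor_mul_of_mul {n : ℕ} (hn : 3 ≤ n) {u v : FreeMonoid (Fin n)}
    (hu : ¬ HasCyclicFactor u) (hv : ¬ HasCyclicFactor v) :
    ∃ i : Fin n, ¬ HasCyclicFactor (u * FreeMonoid.of i * v) := by
  have : NeZero n := ⟨by lia⟩
  obtain ⟨i, hi⟩ : ∃ i, i ∉ ({finRotate n (u.toList.getLast?.getD 0),
      (finRotate n).symm (v.toList.head?.getD 0)} : Finset (Fin n)) := by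
    refine (Finset.exists_mem_notMem_of_card_lt_card (t := Finset.univ) ?_).imp fun _ h => h.2
    exact Finset.card_le_two.trans_lt (by rw [Finset.card_univ, Fintype.card_fin]; lia)
  simp only [Finset.mem_insert, Finset.mem_singleton, not_or] at hi
  refine ⟨i, ?_⟩
  rintro ⟨k, hk⟩
  have hc := isChain_permWord n k
  rcases hc.infix_or_infix_of_infix_append (u := u.toList ++ [i]) (v := v.toList) hk
    (by
      intro x hx y hy
      simp only [List.getLast?_concat, Option.mem_def, Option.some.injEq] at hx hy
      subst hx
      rintro rfl
      simp [hy] at hi) with h | h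
  · rcases hc.infix_or_infix_of_infix_append h
      (by
        intro x hx y hy
        simp only [List.head?_cons, Option.mem_def, Option.some.injEq] at hx hy
        subst hy
        rintro rfl
        simp [hx] at hi) with h | h
    · exact hu ⟨k, h⟩
    · have := h.length_le
      simp [toList_permWord] at this
      lia
  · exact hv ⟨k, h⟩

/-- The congruence identifying all words with a cyclic factor. -/
def cyclicFactorCon (n : ℕ) : Con (FreeMonoid (Fin n)) where
  r x y := x = y ∨ (HasCyclicFactor x ∧ HasCyclicFactor y)
  iseqv :=
    { refl := fun _ => Or.inl rfl
      symm := by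
        rintro x y (rfl | h)
        exacts [Or.inl rfl, Or.inr h.symm]
      trans := by
        rintro x y z (rfl | h) (rfl | h')
        exacts [Or.inl rfl, Or.inr h', Or.inr h, Or.inr ⟨h.1, h'.2⟩] }
  mul' := by
    rintro w x y z (rfl | h) (rfl | h')
    exacts [Or.inl rfl, Or.inr ⟨h'.1.mul_left _, h'.2.mul_left _⟩,
      Or.inr ⟨h.1.mul_right _, h.2.mul_right _⟩, Or.inr ⟨h.1.mul_right _, h.2.mul_right _⟩]

namespace Scyc

variable {n : ℕ}

/-- The canonical projection of the free monoid onto `S_n`. -/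
def mk (n : ℕ) : FreeMonoid (Fin n) →* Scyc n := (conGen (cycRel n)).mk'

theorem mk_surjective : Function.Surjective (mk n) := Con.mk'_surjective

theorem eq_or_hasCyclicFactor_of_mk_eq {u v : FreeMonoid (Fin n)} (h : mk n u = mk n v) :
    u = v ∨ (HasCyclicFactor u ∧ HasCyclicFactor v) := by
  have hle : conGen (cycRel n) ≤ cyclicFactorCon n := by
    refine Con.conGen_le.2 ?_
    rintro x y ⟨rfl, k, rfl⟩
    exact Or.inr ⟨HasCyclicFactor.permWord_finRotate n 0, HasCyclicFactor.permWord_finRotate n k⟩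
  exact hle ((Con.eq _).1 h)

theorem mk_permWord_one : mk n (permWord n 1) = zc n := by
  simp only [permWord, zc, map_list_prod, List.map_map]
  rfl

theorem mk_permWord_finRotate (k : ℕ) : mk n (permWord n (finRotate n ^ k)) = zc n := by
  rw [← mk_permWord_one]
  exact ((Con.eq _).2 (ConGen.Rel.of _ _ ⟨rfl, k, rfl⟩)).symm

theorem permWord_mul_of (m : ℕ) (σ : Equiv.Perm (Fin (m + 1))) :
    permWord (m + 1) σ * FreeMonoid.of (σ 0) =
      FreeMonoid.of (σ 0) * permWord (m + 1) (σ * finRotate (m + 1)) := by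
  have h : permWord (m + 1) (σ * finRotate (m + 1)) =
      ((List.finRange m).map fun i => FreeMonoid.of (σ i.succ)).prod * FreeMonoid.of (σ 0) := by
    rw [permWord, List.finRange_succ_last]
    simp [Function.comp_def]
  rw [h, permWord, List.finRange_succ]
  simp [Function.comp_def, mul_assoc]

theorem finRotate_pow_val_apply_zero (m : ℕ) (i : Fin (m + 1)) :
    (finRotate (m + 1) ^ (i : ℕ)) 0 = i := by
  obtain ⟨k, hk⟩ := i
  induction k with
  | zero => rfl
  | succ k ih =>
    rw [pow_succ', Equiv.Perm.mul_apply, ih (by lia)]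
    exact finRotate_of_lt (by lia)

theorem zc_mul_mk_of (i : Fin n) :
    zc n * mk n (FreeMonoid.of i) = mk n (FreeMonoid.of i) * zc n := by
  obtain _ | m := n
  · exact i.elim0
  have h := congrArg (mk (m + 1)) (permWord_mul_of m (finRotate (m + 1) ^ (i : ℕ)))
  rwa [finRotate_pow_val_apply_zero, ← pow_succ, map_mul, map_mul, mk_permWord_finRotate,
    mk_permWord_finRotate] at h

theorem commute_zc (s : Scyc n) : Commute (zc n) s := by
  obtain ⟨u, rfl⟩ := mk_surjective s
  induction u using FreeMonoid.inductionOn with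
  | one => simp
  | of i => exact zc_mul_mk_of i
  | mul x y hx hy => rw [map_mul]; exact hx.mul_right hy

theorem zc_dvd_mk_iff {u : FreeMonoid (Fin n)} : zc n ∣ mk n u ↔ HasCyclicFactor u := by
  constructor
  · rintro ⟨s, hs⟩
    obtain ⟨v, rfl⟩ := mk_surjective s
    rw [← mk_permWord_one, ← map_mul] at hs
    have hb : HasCyclicFactor (permWord n 1 * v) :=
      (HasCyclicFactor.permWord_finRotate n 0).mul_right v
    rcases eq_or_hasCyclicFactor_of_mk_eq hs with rfl | h
    exacts [hb, h.1]
  · rintro ⟨k, x, y, h⟩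
    have hu : u = FreeMonoid.ofList x * permWord n (finRotate n ^ k) * FreeMonoid.ofList y := h.symm
    rw [hu, map_mul, map_mul, mk_permWord_finRotate, ← (commute_zc _).eq, mul_assoc]
    exact dvd_mul_right _ _

theorem zc_dvd_mul_left {s : Scyc n} (h : zc n ∣ s) (t : Scyc n) : zc n ∣ t * s := by
  obtain ⟨r, rfl⟩ := h
  rw [← mul_assoc, ← (commute_zc t).eq, mul_assoc]
  exact dvd_mul_right _ _

theorem not_zc_dvd_one (hn : n ≠ 0) : ¬ zc n ∣ 1 := by
  rw [← map_one (mk n), zc_dvd_mk_iff]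
  intro h
  simpa [hn] using h.le_length

/-- The length of a chosen word representing an element of `S_n`. -/
noncomputable def length (s : Scyc n) : ℕ := (Function.surjInv mk_surjective s).length

theorem exists_not_zc_dvd_mul_mul (hn : 3 ≤ n) {s t : Scyc n} (hs : ¬ zc n ∣ s)
    (ht : ¬ zc n ∣ t) :
    ∃ w, ¬ zc n ∣ s * w * t := by
  obtain ⟨u, rfl⟩ := mk_surjective s
  obtain ⟨v, rfl⟩ := mk_surjective t
  rw [zc_dvd_mk_iff] at hs ht
  obtain ⟨i, hi⟩ := exists_not_hasCyclicFactor_mul_of_mul hn hs ht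
  exact ⟨mk n (FreeMonoid.of i), by rwa [← map_mul, ← map_mul, zc_dvd_mk_iff]⟩

theorem eq_and_eq_of_mul_mul_eq {s t s' t' w : Scyc n} (h : ¬ zc n ∣ s * w * t)
    (he : s' * w * t' = s * w * t) (hs : s'.length ≤ s.length) (ht : t'.length ≤ t.length) :
    s' = s ∧ t' = t := by
  obtain ⟨x, rfl⟩ := mk_surjective w
  have e (s : Scyc n) : mk n (Function.surjInv mk_surjective s) = s := Function.surjInv_eq _ s
  unfold length at hs ht
  rw [← e s, ← e t] at h he ⊢
  rw [← e s', ← e t'] at he ⊢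
  generalize Function.surjInv mk_surjective s = u at *
  generalize Function.surjInv mk_surjective t = v at *
  generalize Function.surjInv mk_surjective s' = u' at *
  generalize Function.surjInv mk_surjective t' = v' at *
  simp only [← map_mul, zc_dvd_mk_iff] at h he
  have hw := (eq_or_hasCyclicFactor_of_mk_eq he).resolve_right fun h' => h h'.2
  have hl := congrArg FreeMonoid.length hw
  simp only [FreeMonoid.length_mul] at hl
  have hw' : u'.toList ++ (x.toList ++ v'.toList) = u.toList ++ (x.toList ++ v.toList) := by
    simpa [mul_assoc] using congrArg FreeMonoid.toList hw
  obtain ⟨h1, h2⟩ := List.append_inj hw' (show u'.length = u.length by lia)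
  have h3 := List.append_cancel_left h2
  exact ⟨congrArg (mk n) h1, congrArg (mk n) h3⟩

end Scyc

/-- the `K`-linear span `K[P]` of `P = (a_1 ⋯ a_n) S_n` inside `K[S_n]` is a
prime two-sided ideal of `K[S_n]`: it is closed under left and right multiplication by ring
elements, it is proper, and it is prime (expressed elementwise, equivalently via
two-sided ideals `A·B ⊆ Q → A ⊆ Q ∨ B ⊆ Q`). -/
theorem KP_prime (K : Type*) [Field K] (n : ℕ) (hn : 3 ≤ n)
    (KP : Submodule K (MonoidAlgebra K (Scyc n)))
    (hKP : KP = Submodule.span K (MonoidAlgebra.of K (Scyc n) '' {x | ∃ s, x = zc n * s})) :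
    (∀ x ∈ KP, ∀ r : MonoidAlgebra K (Scyc n), r * x ∈ KP ∧ x * r ∈ KP) ∧
    (KP : Set (MonoidAlgebra K (Scyc n))) ≠ Set.univ ∧
    (∀ a b : MonoidAlgebra K (Scyc n), (∀ r, a * r * b ∈ KP) → a ∈ KP ∨ b ∈ KP) := by
  classical
  have hmem (x : MonoidAlgebra K (Scyc n)) : x ∈ KP ↔ ∀ g ∈ x.coeff.support, zc n ∣ g := by
    have : KP = MonoidAlgebra.supported K K {x | zc n ∣ x} := by
      rw [hKP, MonoidAlgebra.supported_eq_span_single]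
      rfl
    rw [this, MonoidAlgebra.mem_supported]
    rfl
  refine ⟨fun x hx r => ?_, fun h => ?_, fun a b hab => ?_⟩
  · rw [hmem] at hx
    simp only [hmem]
    constructor
    · intro g hg
      obtain ⟨p, -, q, hq, rfl⟩ := Finset.mem_mul.1 (MonoidAlgebra.support_coeff_mul_subset _ _ hg)
      exact Scyc.zc_dvd_mul_left (hx q hq) p
    · intro g hg
      obtain ⟨p, hp, q, -, rfl⟩ := Finset.mem_mul.1 (MonoidAlgebra.support_coeff_mul_subset _ _ hg)
      exact (hx p hp).mul_right q
  · have h1 : (1 : MonoidAlgebra K (Scyc n)) ∈ KP := by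
      rw [← SetLike.mem_coe, h]
      trivial
    refine Scyc.not_zc_dvd_one (n := n) (by lia) ((hmem 1).1 h1 1 ?_)
    simp [MonoidAlgebra.support_coeff_one]
  · by_contra! hc
    have hmax {x : MonoidAlgebra K (Scyc n)} (hx : x ∉ KP) : ∃ s ∈ x.coeff.support,
        ¬ zc n ∣ s ∧ ∀ g ∈ x.coeff.support, ¬ zc n ∣ g → g.length ≤ s.length := by
      rw [hmem] at hx
      push Not at hx
      obtain ⟨g, hg, hzg⟩ := hx
      obtain ⟨s, hs, hsmax⟩ := Finset.exists_max_image
        (x.coeff.support.filter fun g => ¬ zc n ∣ g) Scyc.length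
        ⟨g, Finset.mem_filter.2 ⟨hg, hzg⟩⟩
      rw [Finset.mem_filter] at hs
      exact ⟨s, hs.1, hs.2, fun g hg hzg => hsmax g (Finset.mem_filter.2 ⟨hg, hzg⟩)⟩
    obtain ⟨s, hsa, hs, hsmax⟩ := hmax hc.1
    obtain ⟨t, htb, ht, htmax⟩ := hmax hc.2
    obtain ⟨w, hw⟩ := Scyc.exists_not_zc_dvd_mul_mul hn hs ht
    have huniq : ∀ g ∈ a.coeff.support, ∀ h ∈ b.coeff.support,
        g * w * h = s * w * t → g = s ∧ h = t := by
      intro g hg h hh he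
      refine Scyc.eq_and_eq_of_mul_mul_eq hw he (hsmax g hg fun hd => hw ?_)
        (htmax h hh fun hd => hw ?_)
      · exact he ▸ (hd.mul_right w).mul_right h
      · exact he ▸ Scyc.zc_dvd_mul_left hd _
    have hsw : (a * MonoidAlgebra.single w 1).coeff (s * w) = a.coeff s := by
      rw [MonoidAlgebra.coeff_mul_mul_of_uniqueMul]
      · simp
      · intro g h hg hh he
        have hh' : h = w := by
          simpa using Finsupp.support_single_subset hh
        subst hh'
        exact ⟨(huniq g hg t htb (by rw [he])).1, rfl⟩
    have hcoeff : (a * MonoidAlgebra.single w 1 * b).coeff (s * w * t) =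
        a.coeff s * b.coeff t := by
      rw [MonoidAlgebra.coeff_mul_mul_of_uniqueMul, hsw]
      intro g h hg hh he
      obtain ⟨g, hga, rfl⟩ := Finset.mem_image.1
        (MonoidAlgebra.support_coeff_mul_single_subset _ _ _ hg)
      obtain ⟨rfl, rfl⟩ := huniq g hga h hh he
      exact ⟨rfl, rfl⟩
    refine hw ((hmem _).1 (hab (MonoidAlgebra.single w 1)) _ ?_)
    rw [Finsupp.mem_support_iff, hcoeff]
    exact mul_ne_zero (Finsupp.mem_support_iff.1 hsa) (Finsupp.mem_support_iff.1 htb)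
end
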